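/- For G = ES_2(p,n), the orbits of the natural action of Aut(G) on G are exactly: {e} (cardinality 1); Z(G)∖{e} (cardinality p−1); for each b ∈ (ℤ/pℤ)∖{0}, the set O_b = p(ℤ/p²ℤ)×{0}×{b}×{0} (cardinality p); the set G∖H of all elements of order p² (cardinality p^{2n+1}−p^{2n}); and, when n > 1, the set H∖K (cardinality p^{2n}−p²). Consequently G has exactly p+2 automorphism orbits when n = 1 and exactly p+3 automorphism orbits when n > 1. -/

import Mathlib

open Matrix

/-- The additive embedding `ℤ/pℤ → ℤ/p²ℤ`, `a ↦ p·a`. -/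
def emb (p : ℕ) (a : ZMod p) : ZMod (p ^ 2) := (p : ZMod (p ^ 2)) * (a.val : ZMod (p ^ 2))

/-- Reduction modulo `p`, `ℤ/p²ℤ → ℤ/pℤ`. -/
def red (p : ℕ) : ZMod (p ^ 2) →+* ZMod p :=
  ZMod.castHom (dvd_pow_self p (by norm_num)) (ZMod p)

section EmbLemmas

variable {p : ℕ} [NeZero p]

theorem emb_sq_zero : (p : ZMod (p ^ 2)) * (p : ZMod (p ^ 2)) = 0 := by
  have h : ((p ^ 2 : ℕ) : ZMod (p ^ 2)) = 0 := ZMod.natCast_self _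
  push_cast at h
  linear_combination h

theorem emb_mod (k : ℕ) :
    (p : ZMod (p ^ 2)) * ((k % p : ℕ) : ZMod (p ^ 2)) = (p : ZMod (p ^ 2)) * (k : ℕ) := by
  conv_rhs => rw [← Nat.div_add_mod k p]
  push_cast
  linear_combination (-((k / p : ℕ) : ZMod (p ^ 2))) * emb_sq_zero (p := p)

theorem emb_add (a b : ZMod p) : emb p (a + b) = emb p a + emb p b := by
  unfold emb
  rw [ZMod.val_add, emb_mod]
  push_cast
  ring

theorem emb_zero : emb p (0 : ZMod p) = 0 := by
  simp [emb]

theorem emb_neg (a : ZMod p) : emb p (-a) = -emb p a := by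
  have h := emb_add (p := p) (-a) a
  rw [neg_add_cancel, emb_zero] at h
  exact eq_neg_of_add_eq_zero_left h.symm

theorem emb_sub (a b : ZMod p) : emb p (a - b) = emb p a - emb p b := by
  rw [sub_eq_add_neg, emb_add, emb_neg]; ring

theorem emb_mul_emb (a b : ZMod p) : emb p a * emb p b = 0 := by
  unfold emb
  calc (p : ZMod (p ^ 2)) * (a.val : ZMod (p ^ 2)) * ((p : ZMod (p ^ 2)) * (b.val : ZMod (p ^ 2)))
      = ((p : ZMod (p^2)) * (p : ZMod (p^2))) * ((a.val : ZMod (p ^ 2)) * (b.val : ZMod (p ^ 2))) := by ring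
    _ = 0 := by rw [emb_sq_zero]; ring

theorem red_emb (a : ZMod p) : red p (emb p a) = 0 := by
  unfold emb
  rw [_root_.map_mul, map_natCast, ZMod.natCast_self]
  ring

end EmbLemmas

/-- The extra-special `p`-group of exponent `p²` and order `p^(2(m+1)+1)`
(so `n = m + 1` in the paper's notation). -/
@[ext]
structure ES2 (p m : ℕ) : Type where
  u1 : ZMod (p ^ 2)
  u : Fin m → ZMod p
  w1 : ZMod p
  w : Fin m → ZMod p

namespace ES2

variable {p m : ℕ}

instance : Mul (ES2 p m) :=
  ⟨fun x y => ⟨x.u1 + y.u1 + emb p y.w1 * x.u1 + emb p (x.u ⬝ᵥ y.w),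
    x.u + y.u, x.w1 + y.w1, x.w + y.w⟩⟩

@[simp] theorem mul_u1 (x y : ES2 p m) :
    (x * y).u1 = x.u1 + y.u1 + emb p y.w1 * x.u1 + emb p (x.u ⬝ᵥ y.w) := rfl
@[simp] theorem mul_u (x y : ES2 p m) : (x * y).u = x.u + y.u := rfl
@[simp] theorem mul_w1 (x y : ES2 p m) : (x * y).w1 = x.w1 + y.w1 := rfl
@[simp] theorem mul_w (x y : ES2 p m) : (x * y).w = x.w + y.w := rfl

instance : One (ES2 p m) := ⟨⟨0, 0, 0, 0⟩⟩

@[simp] theorem one_u1 : (1 : ES2 p m).u1 = 0 := rfl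
@[simp] theorem one_u : (1 : ES2 p m).u = 0 := rfl
@[simp] theorem one_w1 : (1 : ES2 p m).w1 = 0 := rfl
@[simp] theorem one_w : (1 : ES2 p m).w = 0 := rfl

instance : Inv (ES2 p m) :=
  ⟨fun x => ⟨(1 - emb p x.w1) * (-x.u1 + emb p (x.u ⬝ᵥ x.w)), -x.u, -x.w1, -x.w⟩⟩

@[simp] theorem inv_u1 (x : ES2 p m) :
    (x⁻¹).u1 = (1 - emb p x.w1) * (-x.u1 + emb p (x.u ⬝ᵥ x.w)) := rfl
@[simp] theorem inv_u (x : ES2 p m) : (x⁻¹).u = -x.u := rfl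
@[simp] theorem inv_w1 (x : ES2 p m) : (x⁻¹).w1 = -x.w1 := rfl
@[simp] theorem inv_w (x : ES2 p m) : (x⁻¹).w = -x.w := rfl

instance [NeZero p] : Group (ES2 p m) :=
  Group.ofLeftAxioms
    (fun a b c => by
      ext
      · simp only [mul_u1, mul_u, mul_w1, mul_w, add_dotProduct, dotProduct_add, emb_add]
        linear_combination a.u1 * emb_mul_emb c.w1 b.w1 +
          emb_mul_emb c.w1 (a.u ⬝ᵥ b.w)
      · simp [add_assoc]
      · simp [add_assoc]
      · simp [add_assoc])
    (fun a => by
      ext <;> simp [emb_zero])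
    (fun a => by
      ext
      · simp only [mul_u1, inv_u1, inv_u, inv_w1, inv_w, one_u1, neg_dotProduct, emb_neg]
        linear_combination (a.u1 - emb p (a.u ⬝ᵥ a.w)) * emb_mul_emb a.w1 a.w1
      · simp
      · simp
      · simp)

end ES2

/-- The center `Z(G) = p(ℤ/p²ℤ) × 0 × 0 × 0` of `ES2 p m`. -/
def ZsetES2 (p m : ℕ) : Set (ES2 p m) :=
  {x | (∃ c : ZMod (p ^ 2), x.u1 = (p : ZMod (p ^ 2)) * c) ∧ x.u = 0 ∧ x.w1 = 0 ∧ x.w = 0}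

/-- The subgroup `H = p(ℤ/p²ℤ) × (ℤ/pℤ)^m × (ℤ/pℤ) × (ℤ/pℤ)^m` of elements of order dividing `p`. -/
def HsetES2 (p m : ℕ) : Set (ES2 p m) :=
  {x | ∃ c : ZMod (p ^ 2), x.u1 = (p : ZMod (p ^ 2)) * c}

/-- The subgroup `K = Z(H) = p(ℤ/p²ℤ) × 0 × (ℤ/pℤ) × 0` of `ES2 p m`. -/
def KsetES2 (p m : ℕ) : Set (ES2 p m) :=
  {x | (∃ c : ZMod (p ^ 2), x.u1 = (p : ZMod (p ^ 2)) * c) ∧ x.u = 0 ∧ x.w = 0}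

/-- The set `O_b = p(ℤ/p²ℤ) × 0 × {b} × 0` in `ES2 p m`. -/
def OsetES2 (p m : ℕ) (b : ZMod p) : Set (ES2 p m) :=
  {x | (∃ c : ZMod (p ^ 2), x.u1 = (p : ZMod (p ^ 2)) * c) ∧ x.u = 0 ∧ x.w1 = b ∧ x.w = 0}


namespace ES2
section A
variable {p m : ℕ} [Fact p.Prime]

theorem p_mul (x : ZMod (p^2)) : (p : ZMod (p^2)) * x = emb p (red p x) := by
  obtain ⟨k, rfl⟩ := ZMod.natCast_zmod_surjective x
  rw [map_natCast, emb, ZMod.val_natCast, emb_mod]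

theorem emb_mul' (a : ZMod p) (x : ZMod (p^2)) : emb p a * x = emb p (a * red p x) := by
  obtain ⟨k, rfl⟩ := ZMod.natCast_zmod_surjective a
  have h : emb p (k : ZMod p) = p * (k : ZMod (p^2)) := by
    rw [p_mul, map_natCast]
  rw [h, mul_assoc, p_mul, _root_.map_mul, map_natCast]

theorem emb_eq_zero {a : ZMod p} : emb p a = 0 ↔ a = 0 := by
  constructor
  · intro h
    have hp : 0 < p := (Fact.out : p.Prime).pos
    rw [emb, ← Nat.cast_mul, ZMod.natCast_eq_zero_iff, pow_two] at h
    have h2 := Nat.dvd_of_mul_dvd_mul_left hp h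
    have := Nat.eq_zero_of_dvd_of_lt h2 (ZMod.val_lt a)
    exact (ZMod.val_eq_zero a).1 this
  · rintro rfl; exact emb_zero

theorem emb_inj {a b : ZMod p} : emb p a = emb p b ↔ a = b := by
  rw [← sub_eq_zero, ← emb_sub, emb_eq_zero, sub_eq_zero]

theorem red_eq_zero {x : ZMod (p^2)} : red p x = 0 ↔ ∃ a, x = emb p a := by
  constructor
  · intro h
    obtain ⟨k, rfl⟩ := ZMod.natCast_zmod_surjective x
    rw [map_natCast, ZMod.natCast_eq_zero_iff] at h
    obtain ⟨l, rfl⟩ := h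
    exact ⟨red p l, by push_cast; rw [p_mul]⟩
  · rintro ⟨a, rfl⟩; exact red_emb a

theorem ex_mul {x : ZMod (p^2)} : (∃ c : ZMod (p ^ 2), x = (p : ZMod (p ^ 2)) * c) ↔ red p x = 0 := by
  constructor
  · rintro ⟨c, rfl⟩; rw [p_mul, red_emb]
  · intro h
    obtain ⟨a, rfl⟩ := red_eq_zero.1 h
    exact ⟨_, rfl⟩

theorem red_surj (a : ZMod p) : ∃ x : ZMod (p^2), red p x = a := by
  obtain ⟨k, rfl⟩ := ZMod.natCast_zmod_surjective a
  exact ⟨k, map_natCast _ _⟩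

theorem two_ne (hodd : Odd p) : (2 : ZMod p) ≠ 0 := by
  intro h
  have : ((2 : ℕ) : ZMod p) = 0 := by exact_mod_cast h
  rw [ZMod.natCast_eq_zero_iff] at this
  have h2 := (Nat.prime_dvd_prime_iff_eq (Fact.out : p.Prime) Nat.prime_two).1 this
  subst h2
  exact absurd hodd (by decide)

/-- the first coordinate modulo p -/
def r (x : ES2 p m) : ZMod p := red p x.u1

theorem mul_u1' (x y : ES2 p m) :
    (x * y).u1 = x.u1 + y.u1 + emb p (y.w1 * r x + x.u ⬝ᵥ y.w) := by
  rw [mul_u1, emb_mul', emb_add, r]; ring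

@[simp] theorem mul_r (x y : ES2 p m) : r (x * y) = r x + r y := by
  simp [r, mul_u1', red_emb]

@[simp] theorem one_r : r (1 : ES2 p m) = 0 := by simp [r]

theorem mem_H {x : ES2 p m} : x ∈ HsetES2 p m ↔ r x = 0 := ex_mul
theorem mem_K {x : ES2 p m} : x ∈ KsetES2 p m ↔ r x = 0 ∧ x.u = 0 ∧ x.w = 0 := by
  simp only [KsetES2, Set.mem_ofPred_eq, ex_mul, r]
theorem mem_O {x : ES2 p m} {b : ZMod p} :
    x ∈ OsetES2 p m b ↔ r x = 0 ∧ x.u = 0 ∧ x.w1 = b ∧ x.w = 0 := by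
  simp only [OsetES2, Set.mem_ofPred_eq, ex_mul, r]
theorem mem_Z {x : ES2 p m} : x ∈ ZsetES2 p m ↔ x ∈ OsetES2 p m 0 := by
  simp only [OsetES2, ZsetES2, Set.mem_ofPred_eq]

/-- the symplectic form -/
def om (x y : ES2 p m) : ZMod p :=
  r x * y.w1 - r y * x.w1 + x.u ⬝ᵥ y.w - y.u ⬝ᵥ x.w

theorem mul_left_om (x y z : ES2 p m) : om (x * y) z = om x z + om y z := by
  simp only [om, mul_r, mul_u, mul_w1, mul_w, add_dotProduct, dotProduct_add]; ring

theorem om_anti (x y : ES2 p m) : om x y = - om y x := by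
  simp only [om]; ring

theorem mul_right_om (x y z : ES2 p m) : om z (x * y) = om z x + om z y := by
  rw [om_anti, mul_left_om, om_anti x, om_anti y]; ring

/-- central elements -/
def cz (p m : ℕ) (a : ZMod p) : ES2 p m := ⟨emb p a, 0, 0, 0⟩

theorem comm_eq (x y : ES2 p m) : x * y = y * x * cz p m (om x y) := by
  ext1
  · simp only [mul_u1', cz, om, dotProduct_zero, emb_add, emb_sub, zero_mul, emb_zero,
      mul_comm (y.w1), mul_comm (x.w1)]
    ring
  · simp [cz, add_comm]
  · simp [cz, add_comm]
  · simp [cz, add_comm]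

theorem pow_eq (x : ES2 p m) (k : ℕ) :
    x ^ k = ⟨k * x.u1 + emb p ((k.choose 2 : ℕ) * (x.w1 * r x + x.u ⬝ᵥ x.w)),
      (k : ZMod p) • x.u, k * x.w1, (k : ZMod p) • x.w⟩ := by
  induction k with
  | zero => ext1 <;> simp [emb_zero]
  | succ k ih =>
    rw [pow_succ, ih]
    ext1
    · have hr : r (⟨k * x.u1 + emb p ((k.choose 2 : ℕ) * (x.w1 * r x + x.u ⬝ᵥ x.w)),
        (k : ZMod p) • x.u, k * x.w1, (k : ZMod p) • x.w⟩ : ES2 p m) = k * r x := by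
        simp [r, red_emb]
      rw [mul_u1', hr, Nat.choose_succ_succ' k 1, Nat.choose_one_right]
      simp only [smul_dotProduct, smul_eq_mul, Nat.cast_add, Nat.cast_one, add_mul, one_mul]
      have e : ∀ (a b : ZMod (p^2)) (s t q : ZMod p), s + t = q →
          a + emb p s + b + emb p t = a + b + emb p q := by
        rintro a b s t q rfl
        rw [emb_add]; ring
      apply e
      ring
    · simp [add_smul]
    · simp; ring
    · simp [add_smul]

theorem pow_p (hodd : Odd p) (x : ES2 p m) : x ^ p = cz p m (r x) := by
  have h2 : ((p.choose 2 : ℕ) : ZMod p) = 0 := by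
    rw [ZMod.natCast_eq_zero_iff]
    refine (Fact.out : p.Prime).dvd_choose_self (by norm_num) ?_
    have := (Fact.out : p.Prime).two_le
    rcases this.lt_or_eq with h | h
    · exact h
    · subst h; exact absurd hodd (by decide)
  rw [pow_eq, h2, p_mul]
  ext1 <;> simp [cz, emb_zero, r]

theorem cz_pow (a : ZMod p) (k : ℕ) : (cz p m a) ^ k = cz p m (k * a) := by
  rw [pow_eq]
  have : (k : ZMod (p^2)) * emb p a = emb p (k * a) := by
    rw [mul_comm, emb_mul', map_natCast, mul_comm]
  ext1 <;> simp [cz, emb_zero, this]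

theorem cz_inj {a b : ZMod p} : cz p m a = cz p m b ↔ a = b := by
  constructor
  · intro h
    exact emb_inj.1 (congrArg ES2.u1 h)
  · rintro rfl; rfl

theorem cz_zero : cz p m 0 = 1 := by
  ext1 <;> simp [cz, emb_zero]

theorem H_iff (hodd : Odd p) {x : ES2 p m} : x ∈ HsetES2 p m ↔ x ^ p = 1 := by
  rw [mem_H, pow_p hodd, ← cz_zero, cz_inj]

theorem O_iff (hodd : Odd p) {x : ES2 p m} {b : ZMod p} : x ∈ OsetES2 p m b ↔
    x ^ p = 1 ∧ ∀ g : ES2 p m, g * x = x * g * (g ^ p) ^ b.val := by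
  rw [mem_O, ← H_iff hodd, mem_H]
  apply and_congr_right
  intro hx
  have key : ∀ g : ES2 p m, (g * x = x * g * (g ^ p) ^ b.val) ↔
      r g * x.w1 + g.u ⬝ᵥ x.w - x.u ⬝ᵥ g.w = b * r g := by
    intro g
    rw [comm_eq, pow_p hodd, cz_pow, mul_right_inj, cz_inj, ZMod.natCast_zmod_val, om, hx,
      zero_mul, sub_zero]
  simp only [key]
  constructor
  · rintro ⟨hu, hb, hw⟩ g
    simp [hu, hb, hw, mul_comm]
  · intro h
    refine ⟨?_, ?_, ?_⟩
    · ext i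
      have := h ⟨0, 0, 0, Pi.single i 1⟩
      simpa [r] using this
    · have := h ⟨1, 0, 0, 0⟩
      simpa [r] using this
    · ext i
      have := h ⟨0, Pi.single i 1, 0, 0⟩
      simpa [r] using this

theorem O_inv (hodd : Odd p) (σ : ES2 p m ≃* ES2 p m) {x : ES2 p m} {b : ZMod p} :
    σ x ∈ OsetES2 p m b ↔ x ∈ OsetES2 p m b := by
  rw [O_iff hodd, O_iff hodd, ← map_pow, EmbeddingLike.map_eq_one_iff]
  apply and_congr_right
  intro _
  rw [σ.surjective.forall]
  refine forall_congr' fun g => ?_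
  simp only [← map_pow, ← _root_.map_mul, EmbeddingLike.apply_eq_iff_eq]

theorem H_inv (hodd : Odd p) (σ : ES2 p m ≃* ES2 p m) {x : ES2 p m} :
    σ x ∈ HsetES2 p m ↔ x ∈ HsetES2 p m := by
  rw [H_iff hodd, H_iff hodd, ← map_pow, EmbeddingLike.map_eq_one_iff]

theorem K_O {x : ES2 p m} : x ∈ KsetES2 p m ↔ ∃ b, x ∈ OsetES2 p m b := by
  simp only [mem_K, mem_O]
  constructor
  · rintro ⟨a, b, c⟩; exact ⟨_, a, b, rfl, c⟩
  · rintro ⟨_, a, b, _, c⟩; exact ⟨a, b, c⟩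

theorem K_inv (hodd : Odd p) (σ : ES2 p m ≃* ES2 p m) {x : ES2 p m} :
    σ x ∈ KsetES2 p m ↔ x ∈ KsetES2 p m := by
  simp only [K_O, O_inv hodd]

/-- Classification of elements -/
noncomputable def cls (x : ES2 p m) : ZMod p ⊕ Fin 3 := by
  classical exact
  if x = 1 then .inr 0 else if x ∈ KsetES2 p m then .inl x.w1 else
    if x ∈ HsetES2 p m then .inr 2 else .inr 1

theorem forward (hodd : Odd p) (σ : ES2 p m ≃* ES2 p m) (x : ES2 p m) : cls (σ x) = cls x := by
  unfold cls
  have e1 : σ x = 1 ↔ x = 1 := EmbeddingLike.map_eq_one_iff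
  by_cases h1 : x = 1
  · rw [if_pos h1, if_pos (e1.2 h1)]
  rw [if_neg h1, if_neg (fun h => h1 (e1.1 h))]
  by_cases h2 : x ∈ KsetES2 p m
  · rw [if_pos h2, if_pos ((K_inv hodd σ).2 h2)]
    obtain ⟨b, hb⟩ := K_O.1 h2
    rw [(mem_O.1 hb).2.2.1, (mem_O.1 ((O_inv hodd σ).2 hb)).2.2.1]
  rw [if_neg h2, if_neg (fun h => h2 ((K_inv hodd σ).1 h))]
  by_cases h3 : x ∈ HsetES2 p m
  · rw [if_pos h3, if_pos ((H_inv hodd σ).2 h3)]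
  · rw [if_neg h3, if_neg (fun h => h3 ((H_inv hodd σ).1 h))]

def equivProd : ES2 p m ≃ ZMod (p^2) × (Fin m → ZMod p) × ZMod p × (Fin m → ZMod p) where
  toFun x := (x.u1, x.u, x.w1, x.w)
  invFun x := ⟨x.1, x.2.1, x.2.2.1, x.2.2.2⟩
  left_inv _ := rfl
  right_inv _ := rfl

instance : Finite (ES2 p m) := Finite.of_equiv _ equivProd.symm

/-- scaling -/
def scaleHom (c : ZMod (p^2)) : ES2 p m →* ES2 p m :=
  MonoidHom.mk' (fun x => ⟨c * x.u1, red p c • x.u, x.w1, x.w⟩) (by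
    intro x y
    ext1
    · have h : r (⟨c * x.u1, red p c • x.u, x.w1, x.w⟩ : ES2 p m) = red p c * r x := by
        rw [r, _root_.map_mul, r]
      simp only [mul_u1']
      rw [h, smul_dotProduct, mul_add c, mul_comm c (emb p _), emb_mul', smul_eq_mul]
      ring_nf
    · simp
    · simp
    · simp)

theorem exists_scale (c : ZMod (p^2)) (hc : red p c ≠ 0) :
    ∃ σ : ES2 p m ≃* ES2 p m, ∀ x, σ x = ⟨c * x.u1, red p c • x.u, x.w1, x.w⟩ := by
  have hinj : Function.Injective (scaleHom (m := m) c) := by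
    rw [injective_iff_map_eq_one]
    intro x hx
    have h1 : c * x.u1 = 0 := congrArg ES2.u1 hx
    have h2 : red p c • x.u = 0 := congrArg ES2.u hx
    have h3 : x.w1 = 0 := congrArg ES2.w1 hx
    have h4 : x.w = 0 := congrArg ES2.w hx
    have h5 : red p x.u1 = 0 := by
      have := congrArg (red p) h1
      rw [_root_.map_mul, map_zero] at this
      exact (mul_eq_zero.1 this).resolve_left hc
    obtain ⟨a, ha⟩ := red_eq_zero.1 h5
    rw [ha, mul_comm, emb_mul', emb_eq_zero] at h1
    have h6 := (mul_eq_zero.1 h1).resolve_right hc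
    ext1
    · rw [ha, h6]; exact emb_zero
    · exact (smul_eq_zero.1 h2).resolve_left hc
    · exact h3
    · exact h4
  exact ⟨MulEquiv.ofBijective _ (Finite.injective_iff_bijective.1 hinj), fun x => rfl⟩

/-- transvection -/
def trHom (h2 : (2 : ZMod p) ≠ 0) (v : ES2 p m) (hv : r v = 0) (c : ZMod p) : ES2 p m →* ES2 p m :=
  MonoidHom.mk' (fun x => ⟨x.u1 + emb p (2⁻¹ * ((c * om x v) * (r x * v.w1 + x.u ⬝ᵥ v.w + v.u ⬝ᵥ x.w)
      + (c * om x v)^2 * (v.u ⬝ᵥ v.w))),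
    x.u + (c * om x v) • v.u, x.w1 + (c * om x v) * v.w1, x.w + (c * om x v) • v.w⟩) (by
    intro x y
    ext1
    · simp only [mul_u1']
      rw [mul_left_om]
      have hr : ∀ (t : ZMod p) (a b d), r (⟨x.u1 + emb p t, a, b, d⟩ : ES2 p m) = r x := by
        intro t a b d; simp [r, red_emb]
      rw [hr]
      have e : ∀ (a b : ZMod (p^2)) (s t q w z : ZMod p), s + t = q + w + z →
          a + b + emb p s + emb p t = a + emb p q + (b + emb p w) + emb p z := by
        intro a b s t q w z h
        have : emb p s + emb p t = emb p q + emb p w + emb p z := by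
          rw [← emb_add, h, emb_add, emb_add]
        linear_combination this
      apply e
      simp only [mul_r, mul_u, mul_w, add_dotProduct, dotProduct_add, smul_dotProduct,
        dotProduct_smul, smul_eq_mul]
      have hx : om x v = r x * v.w1 + x.u ⬝ᵥ v.w - v.u ⬝ᵥ x.w := by rw [om, hv]; ring
      have hy : om y v = r y * v.w1 + y.u ⬝ᵥ v.w - v.u ⬝ᵥ y.w := by rw [om, hv]; ring
      rw [hx, hy]
      field_simp
      ring
    · simp [mul_left_om, mul_add, add_smul]; abel
    · simp [mul_left_om]; ring
    · simp [mul_left_om, mul_add, add_smul]; abel)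

theorem exists_tr (hodd : Odd p) (v : ES2 p m) (hv : r v = 0) (c : ZMod p) :
    ∃ σ : ES2 p m ≃* ES2 p m, ∀ x, r (σ x) = r x ∧ (σ x).u = x.u + (c * om x v) • v.u ∧
      (σ x).w1 = x.w1 + (c * om x v) * v.w1 ∧ (σ x).w = x.w + (c * om x v) • v.w := by
  have hr : ∀ x, r (trHom (two_ne hodd) v hv c x) = r x := by
    intro x
    change red p (x.u1 + emb p _) = red p x.u1
    rw [map_add, red_emb, add_zero]
  have hinj : Function.Injective (trHom (two_ne hodd) v hv c) := by
    rw [injective_iff_map_eq_one]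
    intro x hx
    have h1 : x.u1 + emb p (2⁻¹ * ((c * om x v) * (r x * v.w1 + x.u ⬝ᵥ v.w + v.u ⬝ᵥ x.w)
      + (c * om x v)^2 * (v.u ⬝ᵥ v.w))) = 0 := congrArg ES2.u1 hx
    have h2 : x.u + (c * om x v) • v.u = 0 := congrArg ES2.u hx
    have h3 : x.w1 + (c * om x v) * v.w1 = 0 := congrArg ES2.w1 hx
    have h4 : x.w + (c * om x v) • v.w = 0 := congrArg ES2.w hx
    have h5 := hr x
    rw [hx, one_r] at h5
    have h6 : om x v = 0 := by
      generalize c * om x v = k at *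
      rw [om, ← h5, hv, eq_neg_of_add_eq_zero_left h2, eq_neg_of_add_eq_zero_left h4]
      simp
    rw [h6] at h1 h2 h3 h4
    ext1
    · simpa [emb_zero] using h1
    · simpa using h2
    · simpa using h3
    · simpa using h4
  exact ⟨MulEquiv.ofBijective _ (Finite.injective_iff_bijective.1 hinj),
    fun x => ⟨hr x, rfl, rfl, rfl⟩⟩

def Rel (x y : ES2 p m) : Prop := ∃ σ : ES2 p m ≃* ES2 p m, σ x = y

theorem Rel.trans {x y z : ES2 p m} : Rel x y → Rel y z → Rel x z := by
  rintro ⟨s, rfl⟩ ⟨t, rfl⟩; exact ⟨s.trans t, rfl⟩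

theorem Rel.symm {x y : ES2 p m} : Rel x y → Rel y x := by
  rintro ⟨s, rfl⟩; exact ⟨s.symm, by simp⟩

theorem Rel.refl (x : ES2 p m) : Rel x x := ⟨MulEquiv.refl _, rfl⟩

theorem rel_inner {x y g : ES2 p m} (hg : om g x ≠ 0) (hr : r x = r y) (hu : x.u = y.u)
    (hw1 : x.w1 = y.w1) (hw : x.w = y.w) : Rel x y := by
  have h0 : red p (y.u1 - x.u1) = 0 := by
    rw [map_sub]; simp only [r] at hr; rw [hr, sub_self]
  obtain ⟨a, ha⟩ := red_eq_zero.1 h0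
  have hy : y = x * cz p m a := by
    ext1
    · rw [mul_u1']
      simp only [cz, zero_mul, dotProduct_zero, emb_zero, ← ha, add_zero]; ring
    · simp [cz, hu]
    · simp [cz, hw1]
    · simp [cz, hw]
  have hpow : ∀ k : ℕ, om (g ^ k) x = k * om g x := by
    intro k
    induction k with
    | zero => simp [om]
    | succ k ih => rw [pow_succ, mul_left_om, ih]; push_cast; ring
  refine ⟨MulAut.conj (g ^ (a / om g x).val), ?_⟩
  rw [MulAut.conj_apply, comm_eq _ x, hpow, ZMod.natCast_zmod_val, div_mul_cancel₀ _ hg, hy,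
    mul_inv_eq_iff_eq_mul]
  rw [mul_assoc, mul_assoc, comm_eq (g ^ _) (cz p m a)]
  have : om (g ^ (a / om g x).val) (cz p m a) = 0 := by
    simp [om, cz, r, red_emb]
  rw [this, cz_zero, mul_one]

theorem rel_om (hodd : Odd p) {x y : ES2 p m} (hr : r x = r y) (ho : om x y ≠ 0) : Rel x y := by
  let v : ES2 p m := ⟨0, y.u - x.u, y.w1 - x.w1, y.w - x.w⟩
  have hv : r v = 0 := by simp [v, r]
  have hov : om x v = om x y := by
    have h0 : om x v = r x * v.w1 - r v * x.w1 + x.u ⬝ᵥ v.w - v.u ⬝ᵥ x.w := rfl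
    rw [h0, hv, om, ← hr]
    simp only [v, dotProduct_sub, sub_dotProduct]
    ring
  obtain ⟨σ, hσ⟩ := exists_tr hodd v hv (om x y)⁻¹
  obtain ⟨h1, h2, h3, h4⟩ := hσ x
  rw [hov, inv_mul_cancel₀ ho] at h2 h3 h4
  have : Rel x (σ x) := ⟨σ, rfl⟩
  have e2 : (σ x).u = y.u := by rw [h2]; simp [v]
  have e3 : (σ x).w1 = y.w1 := by rw [h3]; simp [v]
  have e4 : (σ x).w = y.w := by rw [h4]; simp [v]
  have e1 : r (σ x) = r y := by rw [h1, hr]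
  refine this.trans (rel_inner (g := x) ?_ e1 e2 e3 e4)
  rwa [om, e1, e2, e3, e4]

theorem rel_notH (hodd : Odd p) {x y : ES2 p m} (hx : r x ≠ 0) (hy : r y ≠ 0) : Rel x y := by
  obtain ⟨c, hc⟩ := red_surj (r y / r x)
  obtain ⟨σ, hσ⟩ := exists_scale (m := m) c (by rw [hc]; exact div_ne_zero hy hx)
  have h1 : Rel x (σ x) := ⟨σ, rfl⟩
  have hr : r (σ x) = r y := by
    rw [hσ, r, _root_.map_mul, hc]; exact div_mul_cancel₀ _ hx
  refine h1.trans ?_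
  generalize σ x = x' at *
  have h3 : ({x'.w1, y.w1} : Finset (ZMod p)) ≠ Finset.univ := by
    intro h
    have := congrArg Finset.card h
    rw [Finset.card_univ, ZMod.card] at this
    have h4 := Finset.card_le_two (a := x'.w1) (b := y.w1)
    have h5 := (Fact.out : p.Prime).two_le
    have h6 : p = 2 := by omega
    rw [h6] at hodd
    exact absurd hodd (by decide)
  obtain ⟨t, ht⟩ : ∃ t, t ∉ ({x'.w1, y.w1} : Finset (ZMod p)) := by
    by_contra! h
    exact h3 (Finset.eq_univ_iff_forall.2 h)
  simp only [Finset.mem_insert, Finset.mem_singleton, not_or] at ht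
  let z : ES2 p m := ⟨y.u1, 0, t, 0⟩
  have hz : r z = r y := rfl
  have ho : ∀ q : ES2 p m, r q = r y → om q z = r y * (t - q.w1) := by
    intro q hq
    have h0 : om q z = r q * z.w1 - r z * q.w1 + q.u ⬝ᵥ z.w - z.u ⬝ᵥ q.w := rfl
    rw [h0, hq, hz]; simp only [z, dotProduct_zero, zero_dotProduct]; ring
  refine (rel_om hodd (y := z) (by rw [hr, hz]) ?_).trans (rel_om hodd (y := z) hz.symm ?_).symm
  · rw [ho _ hr]; exact mul_ne_zero hy (sub_ne_zero.2 ht.1)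
  · rw [ho _ rfl]; exact mul_ne_zero hy (sub_ne_zero.2 ht.2)

theorem exists_om_H {x : ES2 p m} (hx : r x = 0) (hK : x ∉ KsetES2 p m) :
    ∃ z : ES2 p m, r z = 0 ∧ om x z ≠ 0 := by
  by_contra! h
  apply hK
  rw [mem_K]
  refine ⟨hx, ?_, ?_⟩
  · ext i
    have := h ⟨0, 0, 0, Pi.single i 1⟩ (by simp [r])
    simpa [om, r] using this
  · ext i
    have := h ⟨0, Pi.single i 1, 0, 0⟩ (by simp [r])
    simpa [om, r] using this

theorem rel_H (hodd : Odd p) {x y : ES2 p m} (hx : r x = 0) (hy : r y = 0)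
    (hKx : x ∉ KsetES2 p m) (hKy : y ∉ KsetES2 p m) : Rel x y := by
  obtain ⟨a, ha, hxa⟩ := exists_om_H hx hKx
  obtain ⟨b, hb, hyb⟩ := exists_om_H hy hKy
  obtain ⟨z, hz, h1, h2⟩ : ∃ z : ES2 p m, r z = 0 ∧ om x z ≠ 0 ∧ om y z ≠ 0 := by
    by_cases h1 : om y a = 0
    · by_cases h2 : om x b = 0
      · refine ⟨a * b, by simp [ha, hb], ?_, ?_⟩
        · rwa [mul_right_om, h2, add_zero]
        · rwa [mul_right_om, h1, zero_add]
      · exact ⟨b, hb, h2, hyb⟩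
    · exact ⟨a, ha, hxa, h1⟩
  exact (rel_om hodd (by rw [hx, hz]) h1).trans (rel_om hodd (by rw [hy, hz]) h2).symm

theorem O_zero {x : ES2 p m} (h : x ∈ OsetES2 p m 0) : ∃ a, x = cz p m a := by
  obtain ⟨h1, h2, h3, h4⟩ := mem_O.1 h
  obtain ⟨a, ha⟩ := red_eq_zero.1 h1
  exact ⟨a, by ext1 <;> simp [cz, ha, h2, h3, h4]⟩

theorem rel_Z {x y : ES2 p m} (hx : x ∈ OsetES2 p m 0) (hy : y ∈ OsetES2 p m 0)
    (hx1 : x ≠ 1) (hy1 : y ≠ 1) : Rel x y := by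
  obtain ⟨a, rfl⟩ := O_zero hx
  obtain ⟨b, rfl⟩ := O_zero hy
  rw [← cz_zero, Ne, cz_inj] at hx1 hy1
  obtain ⟨c, hc⟩ := red_surj (b / a)
  obtain ⟨σ, hσ⟩ := exists_scale (m := m) c (by rw [hc]; exact div_ne_zero hy1 hx1)
  refine ⟨σ, ?_⟩
  rw [hσ]
  ext1
  · simp only [cz]
    rw [mul_comm, emb_mul', hc, mul_div_cancel₀ _ hx1]
  all_goals simp [cz]

theorem rel_O {x y : ES2 p m} {b : ZMod p} (hb : b ≠ 0) (hx : x ∈ OsetES2 p m b)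
    (hy : y ∈ OsetES2 p m b) : Rel x y := by
  obtain ⟨h1, h2, h3, h4⟩ := mem_O.1 hx
  obtain ⟨k1, k2, k3, k4⟩ := mem_O.1 hy
  refine rel_inner (g := ⟨1, 0, 0, 0⟩) ?_ (h1.trans k1.symm) (h2.trans k2.symm)
    (h3.trans k3.symm) (h4.trans k4.symm)
  simpa [om, r, h1, h2, h3, h4] using hb

theorem one_K : (1 : ES2 p m) ∈ KsetES2 p m := by simp [mem_K]

theorem K_H {x : ES2 p m} (h : x ∈ KsetES2 p m) : x ∈ HsetES2 p m := h.1

theorem K_mem_O {x : ES2 p m} (h : x ∈ KsetES2 p m) : x ∈ OsetES2 p m x.w1 := by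
  rw [mem_K] at h
  exact mem_O.2 ⟨h.1, h.2.1, rfl, h.2.2⟩

/-- the right hand side of the classification -/
def RHS (x y : ES2 p m) : Prop :=
  ((x = 1 ∧ y = 1) ∨
         (x ∈ ZsetES2 p m ∧ x ≠ 1 ∧ y ∈ ZsetES2 p m ∧ y ≠ 1) ∨
         (∃ b : ZMod p, b ≠ 0 ∧ x ∈ OsetES2 p m b ∧ y ∈ OsetES2 p m b) ∨
         (x ∉ HsetES2 p m ∧ y ∉ HsetES2 p m) ∨
         (x ∈ HsetES2 p m ∧ x ∉ KsetES2 p m ∧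
            y ∈ HsetES2 p m ∧ y ∉ KsetES2 p m))

theorem cls_RHS {x y : ES2 p m} (h : cls x = cls y) : RHS x y := by
  unfold RHS
  unfold cls at h
  by_cases hx1 : x = 1
  · by_cases hy1 : y = 1
    · exact .inl ⟨hx1, hy1⟩
    · rw [if_pos hx1, if_neg hy1] at h
      split_ifs at h <;> simp at h
  by_cases hy1 : y = 1
  · rw [if_neg hx1, if_pos hy1] at h
    split_ifs at h <;> simp at h
  rw [if_neg hx1, if_neg hy1] at h
  right
  by_cases hx : x ∈ KsetES2 p m
  · by_cases hy : y ∈ KsetES2 p m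
    · rw [if_pos hx, if_pos hy, Sum.inl.injEq] at h
      have a := K_mem_O hx
      have b := K_mem_O hy
      rw [← h] at b
      by_cases h0 : x.w1 = 0
      · rw [h0] at a b
        exact .inl ⟨mem_Z.2 a, hx1, mem_Z.2 b, hy1⟩
      · exact .inr (.inl ⟨_, h0, a, b⟩)
    · rw [if_pos hx, if_neg hy] at h
      split_ifs at h
  by_cases hy : y ∈ KsetES2 p m
  · rw [if_neg hx, if_pos hy] at h
    split_ifs at h
  rw [if_neg hx, if_neg hy] at h
  right; right
  split_ifs at h with h1 h2 h3
  · exact .inr ⟨h1, hx, h2, hy⟩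
  · simp at h
  · simp at h
  · exact .inl ⟨h1, h3⟩

theorem RHS_rel (hodd : Odd p) {x y : ES2 p m} (h : RHS x y) : Rel x y := by
  rcases h with ⟨rfl, rfl⟩ | ⟨h1, h2, h3, h4⟩ | ⟨b, hb, h1, h2⟩ | ⟨h1, h2⟩ | ⟨h1, h2, h3, h4⟩
  · exact Rel.refl _
  · exact rel_Z (mem_Z.1 h1) (mem_Z.1 h3) h2 h4
  · exact rel_O hb h1 h2
  · rw [mem_H] at h1 h2; exact rel_notH hodd h1 h2
  · rw [mem_H] at h1 h3; exact rel_H hodd h1 h3 h2 h4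

theorem rel_cls (hodd : Odd p) {x y : ES2 p m} : Rel x y ↔ cls x = cls y := by
  constructor
  · rintro ⟨σ, rfl⟩; exact (forward hodd σ x).symm
  · exact fun h => RHS_rel hodd (cls_RHS h)

theorem rel_RHS (hodd : Odd p) {x y : ES2 p m} : Rel x y ↔ RHS x y :=
  ⟨fun h => cls_RHS ((rel_cls hodd).1 h), RHS_rel hodd⟩

theorem card_all : Nat.card (ES2 p m) = p ^ (2 * (m + 1) + 1) := by
  rw [Nat.card_congr equivProd]
  simp only [Nat.card_prod, Nat.card_zmod, Nat.card_fun, Nat.card_fin]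
  ring

def toH (z : ZMod p × (Fin m → ZMod p) × ZMod p × (Fin m → ZMod p)) : ES2 p m :=
  ⟨emb p z.1, z.2.1, z.2.2.1, z.2.2.2⟩

theorem card_H : (HsetES2 p m).ncard = p ^ (2 * (m + 1)) := by
  have h : HsetES2 p m = Set.range toH := by
    ext x
    rw [mem_H, r, red_eq_zero]
    constructor
    · rintro ⟨a, ha⟩; exact ⟨(a, x.u, x.w1, x.w), by ext1 <;> simp [toH, ha]⟩
    · rintro ⟨z, rfl⟩; exact ⟨_, rfl⟩
  have hi : Function.Injective (toH (p := p) (m := m)) := by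
    rintro ⟨a, b, c, d⟩ ⟨a', b', c', d'⟩ h
    simp only [toH, ES2.mk.injEq, emb_inj] at h
    simp [h]
  rw [h, ← Nat.card_coe_set_eq, Nat.card_range_of_injective hi]
  simp only [Nat.card_prod, Nat.card_zmod, Nat.card_fun, Nat.card_fin]
  ring

theorem card_K : (KsetES2 p m).ncard = p ^ 2 := by
  have h : KsetES2 p m = Set.range (fun z : ZMod p × ZMod p => toH (m := m) (z.1, 0, z.2, 0)) := by
    ext x
    rw [mem_K, r, red_eq_zero]
    constructor
    · rintro ⟨⟨a, ha⟩, h1, h2⟩; exact ⟨(a, x.w1), by ext1 <;> simp [toH, ha, h1, h2]⟩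
    · rintro ⟨z, rfl⟩; exact ⟨⟨_, rfl⟩, rfl, rfl⟩
  have hi : Function.Injective (fun z : ZMod p × ZMod p => toH (m := m) (z.1, 0, z.2, 0)) := by
    rintro ⟨a, b⟩ ⟨a', b'⟩ h
    simp only [toH, ES2.mk.injEq, emb_inj] at h
    simp [h]
  rw [h, ← Nat.card_coe_set_eq, Nat.card_range_of_injective hi]
  simp only [Nat.card_prod, Nat.card_zmod]
  ring

theorem card_O (b : ZMod p) : (OsetES2 p m b).ncard = p := by
  have h : OsetES2 p m b = Set.range (fun z : ZMod p => toH (m := m) (z, 0, b, 0)) := by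
    ext x
    rw [mem_O, r, red_eq_zero]
    constructor
    · rintro ⟨⟨a, ha⟩, h1, h2, h3⟩; exact ⟨a, by ext1 <;> simp [toH, ha, h1, h2, h3]⟩
    · rintro ⟨z, rfl⟩; exact ⟨⟨_, rfl⟩, rfl, rfl, rfl⟩
  have hi : Function.Injective (fun z : ZMod p => toH (m := m) (z, 0, b, 0)) := by
    intro a a' h
    simpa only [toH, ES2.mk.injEq, emb_inj, and_true] using h
  rw [h, ← Nat.card_coe_set_eq, Nat.card_range_of_injective hi, Nat.card_zmod]

theorem card_orbits (hodd : Odd p) :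
    Nat.card {S : Set (ES2 p m) | ∃ x : ES2 p m, S = {y | Rel x y}}
      = Nat.card (Set.range (cls (p := p) (m := m))) := by
  have h : {S : Set (ES2 p m) | ∃ x : ES2 p m, S = {y | Rel x y}} =
      (fun c => {y | c = cls y}) '' Set.range (cls (p := p) (m := m)) := by
    ext S
    simp only [rel_cls hodd]
    constructor
    · rintro ⟨x, rfl⟩; exact ⟨_, ⟨x, rfl⟩, rfl⟩
    · rintro ⟨_, ⟨x, rfl⟩, rfl⟩; exact ⟨x, rfl⟩
  rw [h]
  apply Nat.card_image_of_injOn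
  rintro _ ⟨x, rfl⟩ _ ⟨y, rfl⟩ h
  have : y ∈ {z | cls y = cls z} := rfl
  have h' : {z | cls x = cls z} = {z | cls y = cls z} := h
  rw [← h'] at this
  exact this

theorem one_ne_zero' : (1 : ZMod p) ≠ 0 := one_ne_zero

theorem cls_one : cls (1 : ES2 p m) = .inr 0 := by simp [cls]

theorem cls_inl (b : ZMod p) : cls (toH (1, 0, b, 0) : ES2 p m) = .inl b := by
  have h1 : (toH (1, 0, b, 0) : ES2 p m) ≠ 1 := by
    intro h
    exact one_ne_zero' (emb_eq_zero.1 (congrArg ES2.u1 h))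
  have h2 : (toH (1, 0, b, 0) : ES2 p m) ∈ KsetES2 p m := by
    rw [mem_K]; exact ⟨red_emb _, rfl, rfl⟩
  rw [cls, if_neg h1, if_pos h2]; rfl

theorem cls_notH : cls (⟨1, 0, 0, 0⟩ : ES2 p m) = .inr 1 := by
  have h3 : (⟨1, 0, 0, 0⟩ : ES2 p m) ∉ HsetES2 p m := by
    rw [mem_H]; simp [r]
  have h2 : (⟨1, 0, 0, 0⟩ : ES2 p m) ∉ KsetES2 p m := fun h => h3 (K_H h)
  have h1 : (⟨1, 0, 0, 0⟩ : ES2 p m) ≠ 1 := fun h => h2 (h ▸ one_K)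
  rw [cls, if_neg h1, if_neg h2, if_neg h3]

theorem cls_H (i : Fin m) : cls (⟨0, Pi.single i 1, 0, 0⟩ : ES2 p m) = .inr 2 := by
  have h3 : (⟨0, Pi.single i 1, 0, 0⟩ : ES2 p m) ∈ HsetES2 p m := by
    rw [mem_H]; simp [r]
  have h2 : (⟨0, Pi.single i 1, 0, 0⟩ : ES2 p m) ∉ KsetES2 p m := by
    rw [mem_K]; simp
  have h1 : (⟨0, Pi.single i 1, 0, 0⟩ : ES2 p m) ≠ 1 := fun h => h2 (h ▸ one_K)
  rw [cls, if_neg h1, if_neg h2, if_pos h3]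

theorem card_range : Nat.card (Set.range (cls (p := p) (m := m))) =
    if m = 0 then p + 2 else p + 3 := by
  split_ifs with hm
  · have : Set.range (cls (p := p) (m := m)) = {Sum.inr 2}ᶜ := by
      ext s
      rw [Set.mem_compl_singleton_iff]
      constructor
      · rintro ⟨x, rfl⟩ h
        subst hm
        unfold cls at h
        split_ifs at h with h1 h2 h3
        · simp at h
        · exact h2 (mem_K.2 ⟨mem_H.1 h3, Subsingleton.elim _ _, Subsingleton.elim _ _⟩)
        · simp at h
      · rcases s with b | i
        · intro _; exact ⟨_, cls_inl b⟩
        · fin_cases i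
          · intro _; exact ⟨_, cls_one⟩
          · intro _; exact ⟨_, cls_notH⟩
          · intro h; exact absurd rfl h
    rw [this, Nat.card_coe_set_eq, Set.ncard_compl, Set.ncard_singleton]
    simp
  · have : Set.range (cls (p := p) (m := m)) = Set.univ := by
      rw [Set.range_eq_univ]
      rintro (b | i)
      · exact ⟨_, cls_inl b⟩
      · fin_cases i
        · exact ⟨_, cls_one⟩
        · exact ⟨_, cls_notH⟩
        · exact ⟨_, cls_H ⟨0, Nat.pos_of_ne_zero hm⟩⟩
    rw [this, Nat.card_coe_set_eq, Set.ncard_univ]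
    simp

end A
end ES2

theorem ES2_automorphism_orbits (p m : ℕ) [Fact p.Prime] (hodd : Odd p) :
    (∀ x y : ES2 p m,
      (∃ σ : ES2 p m ≃* ES2 p m, σ x = y) ↔
        ((x = 1 ∧ y = 1) ∨
         (x ∈ ZsetES2 p m ∧ x ≠ 1 ∧ y ∈ ZsetES2 p m ∧ y ≠ 1) ∨
         (∃ b : ZMod p, b ≠ 0 ∧ x ∈ OsetES2 p m b ∧ y ∈ OsetES2 p m b) ∨
         (x ∉ HsetES2 p m ∧ y ∉ HsetES2 p m) ∨
         (x ∈ HsetES2 p m ∧ x ∉ KsetES2 p m ∧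
            y ∈ HsetES2 p m ∧ y ∉ KsetES2 p m))) ∧
    Nat.card {x : ES2 p m | x ∈ ZsetES2 p m ∧ x ≠ 1} = p - 1 ∧
    (∀ b : ZMod p, b ≠ 0 → Nat.card (OsetES2 p m b) = p) ∧
    Nat.card {x : ES2 p m | x ∉ HsetES2 p m}
        = p ^ (2 * (m + 1) + 1) - p ^ (2 * (m + 1)) ∧
    (0 < m → Nat.card {x : ES2 p m | x ∈ HsetES2 p m ∧ x ∉ KsetES2 p m}
        = p ^ (2 * (m + 1)) - p ^ 2) ∧
    Nat.card {S : Set (ES2 p m) |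
        ∃ x : ES2 p m, S = {y | ∃ σ : ES2 p m ≃* ES2 p m, σ x = y}}
      = if m = 0 then p + 2 else p + 3 := by
  refine ⟨fun x y => ES2.rel_RHS hodd, ?_, fun b _ => ES2.card_O b, ?_, fun _ => ?_, ?_⟩
  · have : {x : ES2 p m | x ∈ ZsetES2 p m ∧ x ≠ 1} = OsetES2 p m 0 \ {1} := by
      ext x; simp [ES2.mem_Z]
    rw [this, Nat.card_coe_set_eq, Set.ncard_diff_singleton_of_mem, ES2.card_O]
    simp [ES2.mem_O]
  · have : {x : ES2 p m | x ∉ HsetES2 p m} = (HsetES2 p m)ᶜ := rfl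
    rw [this, Nat.card_coe_set_eq, Set.ncard_compl, ES2.card_H, ES2.card_all]
  · have : {x : ES2 p m | x ∈ HsetES2 p m ∧ x ∉ KsetES2 p m} = HsetES2 p m \ KsetES2 p m := rfl
    rw [this, Nat.card_coe_set_eq, Set.ncard_diff (fun x hx => ES2.K_H hx), ES2.card_H,
      ES2.card_K]
  · exact (ES2.card_orbits hodd).trans ES2.card_range
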